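/- Telescoping error bound at a single node along its root path: let $\mathcal{X}_1,\dots,\mathcal{X}_d$ be finite nonempty sets and let $P_k = \mathcal{X}_1\times\dots\times\mathcal{X}_k$. Under the hypotheses (a)–(c) of the deterministic TopDown setting (hierarchically consistent true counts $q_k$, noisy values $\tilde{q}_k$, and privatized counts $\bar{q}_k$ obtained by level-wise constrained Chebyshev minimization with $\bar{q}_0 = q_0$), for every $1 \le k \le d$ and every node $u_k \in P_k$ with ancestors $u_0, u_1, \dots, u_{k-1}$ (where $u_\ell \in P_\ell$ is the length-$\ell$ prefix of $u_k$), one has $|q_k(u_k) - \bar{q}_k(u_k)| \le 2 \sum_{\ell=1}^{k} \max_{y \in \mathcal{X}_\ell} |\tilde{q}_\ell(u_{\ell-1}, y) - q_\ell(u_{\ell-1}, y)|$. -/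

import Mathlib

/-- Below a family of naturals one finds families of every smaller total. -/
theorem exists_le_sum_eq {ι : Type*} [Fintype ι] (f : ι → ℕ) (m : ℕ) (hm : m ≤ ∑ z, f z) :
    ∃ x : ι → ℕ, x ≤ f ∧ ∑ z, x z = m := by
  classical
  induction m with
  | zero => exact ⟨0, fun _ => Nat.zero_le _, by simp⟩
  | succ m ih =>
    obtain ⟨x, hxf, hx⟩ := ih (by omega)
    obtain ⟨z, -, hz⟩ := Finset.exists_lt_of_sum_lt (s := Finset.univ) (f := x) (g := f) (by omega)
    refine ⟨x + Pi.single z 1, fun w => ?_, ?_⟩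
    · by_cases h : w = z
      · subst h
        simpa using hz
      · simpa [h] using hxf w
    · simp [Finset.sum_add_distrib, hx]

/-- The total of a family of naturals can be changed to any `m` while moving each entry by at most
the change in the total. -/
theorem exists_sum_eq_natAbs_sub_le {ι : Type*} [Fintype ι] [Nonempty ι] (f : ι → ℕ) (m : ℕ) :
    ∃ x : ι → ℕ, ∑ z, x z = m ∧
      ∀ z, ((f z : ℤ) - x z).natAbs ≤ (((∑ w, f w : ℕ) : ℤ) - m).natAbs := by
  classical
  rcases le_total m (∑ z, f z) with hm | hm
  · obtain ⟨x, hxf, hx⟩ := exists_le_sum_eq f m hm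
    refine ⟨x, hx, fun z => ?_⟩
    have hsum : ∑ w, (f w - x w) + ∑ w, x w = ∑ w, f w := by
      rw [← Finset.sum_add_distrib]
      exact Finset.sum_congr rfl fun w _ => Nat.sub_add_cancel (hxf w)
    have hz : f z - x z ≤ ∑ w, (f w - x w) :=
      Finset.single_le_sum (f := fun w => f w - x w) (fun _ _ => Nat.zero_le _) (Finset.mem_univ z)
    have hxz : x z ≤ f z := hxf z
    omega
  · obtain ⟨z₀⟩ := ‹Nonempty ι›
    refine ⟨f + Pi.single z₀ (m - ∑ z, f z), ?_, fun z => ?_⟩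
    · simp [Finset.sum_add_distrib, hm]
    · by_cases h : z = z₀
      · subst h
        simp only [Pi.add_apply, Pi.single_eq_same]
        omega
      · simp [h]

/-- A Chebyshev-optimal family `p` of total `m` for the noisy values `t` differs from `f` by at most
twice the noise plus the difference of the totals. -/
theorem natAbs_sub_le_of_chebyshev_optimal {ι : Type*} [Fintype ι] [Nonempty ι]
    (f p : ι → ℕ) (t : ι → ℤ) (m : ℕ)
    (hp : ∀ x : ι → ℕ, ∑ z, x z = m →
      (Finset.univ.sup fun z => (t z - (p z : ℤ)).natAbs)
        ≤ Finset.univ.sup fun z => (t z - (x z : ℤ)).natAbs) (z : ι) :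
    ((f z : ℤ) - p z).natAbs ≤ (((∑ w, f w : ℕ) : ℤ) - m).natAbs
      + 2 * Finset.univ.sup fun z => (t z - (f z : ℤ)).natAbs := by
  obtain ⟨x, hx, hfx⟩ := exists_sum_eq_natAbs_sub_le f m
  have noise (w : ι) : (t w - (f w : ℤ)).natAbs
      ≤ Finset.univ.sup fun z => (t z - (f z : ℤ)).natAbs :=
    Finset.le_sup (f := fun z => (t z - (f z : ℤ)).natAbs) (Finset.mem_univ w)
  have hxt : (Finset.univ.sup fun z => (t z - (x z : ℤ)).natAbs)
      ≤ (((∑ w, f w : ℕ) : ℤ) - m).natAbs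
        + Finset.univ.sup fun z => (t z - (f z : ℤ)).natAbs := by
    refine Finset.sup_le fun w _ => ?_
    have := hfx w
    have := noise w
    omega
  have hpz : (t z - (p z : ℤ)).natAbs ≤ Finset.univ.sup fun z => (t z - (p z : ℤ)).natAbs :=
    Finset.le_sup (f := fun z => (t z - (p z : ℤ)).natAbs) (Finset.mem_univ z)
  have := hp x hx
  have := noise z
  omega

/-- **Telescoping error bound at a single node along its root path.**

Nodes at level `k` of the hierarchical tree (i.e. elements of
`P_k = X_1 × ⋯ × X_k`) are encoded as full tuples `u : ∀ i, X i` together with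
the hypothesis that the level-`k` functions depend only on the first `k`
coordinates; the ancestor `u_ℓ ∈ P_ℓ` of `u` is its length-`ℓ` prefix, and the
node `(u_{ℓ-1}, y)` with `y ∈ X_ℓ` is `Function.update u (ℓ-1) y` (0-indexed).

Under the deterministic TopDown hypotheses (hierarchically consistent true
counts `q`, noisy values `tq`, privatized counts `qbar` obtained by level-wise
constrained Chebyshev minimization with `qbar 0 = q 0`), for every `1 ≤ k ≤ d`
and every node `u` at level `k`,
`|q_k(u) - qbar_k(u)| ≤ 2 ∑_{ℓ=1}^{k} max_{y ∈ X_ℓ} |tq_ℓ(u_{ℓ-1},y) - q_ℓ(u_{ℓ-1},y)|`. -/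
theorem topdown_root_path_error_bound
    {d : ℕ} (X : Fin d → Type) [∀ i, Fintype (X i)] [∀ i, Nonempty (X i)]
    (q : ℕ → (∀ i, X i) → ℕ)
    (tq : ℕ → (∀ i, X i) → ℤ)
    (qbar : ℕ → (∀ i, X i) → ℕ)
    -- the level-`k` functions depend only on the first `k` coordinates
    (hq_pref : ∀ k, k ≤ d → ∀ u v : ∀ i, X i,
      (∀ i : Fin d, i.val < k → u i = v i) → q k u = q k v)
    (htq_pref : ∀ k, k ≤ d → ∀ u v : ∀ i, X i,
      (∀ i : Fin d, i.val < k → u i = v i) → tq k u = tq k v)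
    (hqbar_pref : ∀ k, k ≤ d → ∀ u v : ∀ i, X i,
      (∀ i : Fin d, i.val < k → u i = v i) → qbar k u = qbar k v)
    -- (a) hierarchical consistency of the true counts
    (hcons : ∀ (k : ℕ) (hk : k < d), ∀ u : ∀ i, X i,
      q k u = ∑ z : X ⟨k, hk⟩, q (k + 1) (Function.update u ⟨k, hk⟩ z))
    -- (c) root condition
    (hroot : ∀ u : ∀ i, X i, qbar 0 u = q 0 u)
    -- (c) level-wise consistency constraint and Chebyshev optimality
    (hopt : ∀ (k : ℕ) (hk : k < d), ∀ u : ∀ i, X i,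
      (∑ z : X ⟨k, hk⟩, qbar (k + 1) (Function.update u ⟨k, hk⟩ z) = qbar k u) ∧
      ∀ x : X ⟨k, hk⟩ → ℕ, (∑ z, x z = qbar k u) →
        (Finset.univ.sup fun z : X ⟨k, hk⟩ =>
            (tq (k + 1) (Function.update u ⟨k, hk⟩ z)
              - (qbar (k + 1) (Function.update u ⟨k, hk⟩ z) : ℤ)).natAbs)
          ≤ Finset.univ.sup fun z : X ⟨k, hk⟩ =>
              (tq (k + 1) (Function.update u ⟨k, hk⟩ z) - (x z : ℤ)).natAbs) :
    ∀ k, 1 ≤ k → ∀ (hkd : k ≤ d), ∀ u : ∀ i, X i,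
      ((q k u : ℤ) - (qbar k u : ℤ)).natAbs
        ≤ 2 * ∑ ℓ : Fin k,
            Finset.univ.sup fun z : X ⟨ℓ.val, lt_of_lt_of_le ℓ.isLt hkd⟩ =>
              (tq (ℓ.val + 1) (Function.update u ⟨ℓ.val, lt_of_lt_of_le ℓ.isLt hkd⟩ z)
                - (q (ℓ.val + 1)
                    (Function.update u ⟨ℓ.val, lt_of_lt_of_le ℓ.isLt hkd⟩ z) : ℤ)).natAbs := by
  intro k _
  clear * - hcons hroot hopt
  induction k with
  | zero =>
    intro _ u
    simp [hroot u]
  | succ k ih =>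
    intro hkd u
    have hstep := natAbs_sub_le_of_chebyshev_optimal
      (fun z => q (k + 1) (Function.update u ⟨k, hkd⟩ z))
      (fun z => qbar (k + 1) (Function.update u ⟨k, hkd⟩ z))
      (fun z => tq (k + 1) (Function.update u ⟨k, hkd⟩ z))
      (qbar k u) (hopt k hkd u).2 (u ⟨k, hkd⟩)
    rw [← hcons k hkd u] at hstep
    simp only [Function.update_eq_self] at hstep
    rw [Fin.sum_univ_castSucc, mul_add]
    exact hstep.trans (Nat.add_le_add_right (ih (Nat.le_of_succ_le hkd) u) _)
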